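/- There exists a constant c > 0 such that for every nonzero a⁰ ∈ ℓ¹(ℤ²; ℂ), setting T = c ‖a⁰‖_{ℓ¹(ℤ²)}^{−2}, there exists a unique continuously differentiable curve a : [−T, T] → ℓ¹(ℤ²; ℂ) with a(0) = a⁰ satisfying −i a′(t) = 𝒩(t)(a(t), a(t), a(t)) for all t ∈ [−T, T]. -/

import Mathlib

open scoped BigOperators ENNReal

noncomputable section

/-- The squared Euclidean length of a lattice point `n ∈ ℤ²`. -/
def nsq (n : ℤ × ℤ) : ℤ := n.1 ^ 2 + n.2 ^ 2

/-- The set `Γ(n)` of non-self interactions at frequency `n`. -/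
def Gam (n : ℤ × ℤ) : Set ((ℤ × ℤ) × (ℤ × ℤ) × (ℤ × ℤ)) :=
  {p | p.1 - p.2.1 + p.2.2 = n ∧ p.1 ≠ n ∧ p.2.2 ≠ n}

/-- `ω₄ = |n₁|² − |n₂|² + |n₃|² − |n|²`. -/
def omega4 (n : ℤ × ℤ) (p : (ℤ × ℤ) × (ℤ × ℤ) × (ℤ × ℤ)) : ℤ :=
  nsq p.1 - nsq p.2.1 + nsq p.2.2 - nsq n

/-- The summand `a_{n₁} conj(b_{n₂}) c_{n₃} e^{iω₄ t}`. -/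
def Nterm (t : ℝ) (a b c : (ℤ × ℤ) → ℂ) (n : ℤ × ℤ)
    (p : (ℤ × ℤ) × (ℤ × ℤ) × (ℤ × ℤ)) : ℂ :=
  a p.1 * (starRingEnd ℂ) (b p.2.1) * c p.2.2 *
    Complex.exp (Complex.I * (omega4 n p : ℂ) * (t : ℂ))

/-- The trilinear operator `𝒩(t)(a,b,c)_n`. -/
def Nop (t : ℝ) (a b c : (ℤ × ℤ) → ℂ) (n : ℤ × ℤ) : ℂ :=
  -(a n * (starRingEnd ℂ) (b n) * c n) + ∑' p : Gam n, Nterm t a b c n ↑p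

/-- `a` is a continuously differentiable solution of `FNLS`, `−i ∂ₜ a = 𝒩(t)(a,a,a)`,
on the set `S` of times. -/
def IsFNLSSolOn (S : Set ℝ) (a : ℝ → lp (fun _ : ℤ × ℤ => ℂ) 1) : Prop :=
  ∃ a' : ℝ → lp (fun _ : ℤ × ℤ => ℂ) 1,
    ContinuousOn a' S ∧
    (∀ t ∈ S, HasDerivWithinAt a (a' t) S t) ∧
    (∀ t ∈ S, ∀ n : ℤ × ℤ,
      -Complex.I * (a' t) n = Nop t (⇑(a t)) (⇑(a t)) (⇑(a t)) n)

open scoped NNReal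
open Set Metric

/-- The space `ℓ¹(ℤ²; ℂ)`. -/
abbrev EllOne : Type := lp (fun _ : ℤ × ℤ => ℂ) 1

theorem EllOne.hasSum_norm (a : EllOne) : HasSum (fun n => ‖a n‖) ‖a‖ := by
  simpa using lp.hasSum_norm (p := 1) (by simp) a

/-- The product of absolute values `|a_{n₁}| |b_{n₂}| |c_{n₃}|`. -/
def absProd (a b c : EllOne) (p : (ℤ × ℤ) × (ℤ × ℤ) × (ℤ × ℤ)) : ℝ :=
  ‖a p.1‖ * (‖b p.2.1‖ * ‖c p.2.2‖)

theorem hasSum_absProd (a b c : EllOne) : HasSum (absProd a b c) (‖a‖ * (‖b‖ * ‖c‖)) := by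
  have hbc := b.hasSum_norm.mul c.hasSum_norm
    (b.hasSum_norm.summable.mul_of_nonneg c.hasSum_norm.summable
      (fun _ => norm_nonneg _) (fun _ => norm_nonneg _))
  exact a.hasSum_norm.mul hbc
    (a.hasSum_norm.summable.mul_of_nonneg hbc.summable
      (fun _ => norm_nonneg _) (fun _ => by positivity))

/-- The frequency `n₁ − n₂ + n₃` which the triple `(n₁, n₂, n₃)` feeds into. -/
def outFreq (p : (ℤ × ℤ) × (ℤ × ℤ) × (ℤ × ℤ)) : ℤ × ℤ := p.1 - p.2.1 + p.2.2

open Classical in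
/-- The coefficient of the interaction `(n₁, n₂, n₃)` in the nonlinearity at time `t`. -/
def fnlsCoeff (t : ℝ) (p : (ℤ × ℤ) × (ℤ × ℤ) × (ℤ × ℤ)) : ℂ :=
  (if p ∈ Gam (outFreq p) then Complex.exp (Complex.I * (omega4 (outFreq p) p : ℂ) * (t : ℂ))
    else 0) - if p = (p.2.1, p.2.1, p.2.1) then 1 else 0

theorem norm_fnlsCoeff_le (t : ℝ) (p : (ℤ × ℤ) × (ℤ × ℤ) × (ℤ × ℤ)) :
    ‖fnlsCoeff t p‖ ≤ 1 := by
  unfold fnlsCoeff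
  by_cases hd : p = (p.2.1, p.2.1, p.2.1)
  · have hg : p ∉ Gam (outFreq p) := by
      rw [hd]
      simp [Gam, outFreq]
    rw [if_neg hg, if_pos hd]
    simp
  · rw [if_neg hd, sub_zero]
    split_ifs
    · have : Complex.I * (omega4 (outFreq p) p : ℂ) * (t : ℂ)
          = ((omega4 (outFreq p) p * t : ℝ) : ℂ) * Complex.I := by
        push_cast
        ring
      rw [this, Complex.norm_exp_ofReal_mul_I]
    · simp

theorem continuous_fnlsCoeff (p : (ℤ × ℤ) × (ℤ × ℤ) × (ℤ × ℤ)) :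
    Continuous fun t => fnlsCoeff t p := by
  unfold fnlsCoeff
  split_ifs <;> fun_prop

/-- The contribution of the interaction `(n₁, n₂, n₃)` to the nonlinearity. -/
def fnlsTerm (t : ℝ) (a : EllOne) (p : (ℤ × ℤ) × (ℤ × ℤ) × (ℤ × ℤ)) : EllOne :=
  lp.single 1 (outFreq p) (fnlsCoeff t p * (a p.1 * (starRingEnd ℂ) (a p.2.1) * a p.2.2))

theorem norm_fnlsTerm_le (t : ℝ) (a : EllOne) (p : (ℤ × ℤ) × (ℤ × ℤ) × (ℤ × ℤ)) :
    ‖fnlsTerm t a p‖ ≤ absProd a a a p := by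
  rw [fnlsTerm, lp.norm_single one_pos, norm_mul]
  refine (mul_le_of_le_one_left (norm_nonneg _) (norm_fnlsCoeff_le t p)).trans_eq ?_
  simp [absProd, mul_assoc]

theorem norm_fnlsTerm_sub_le (t : ℝ) (a b : EllOne) (p : (ℤ × ℤ) × (ℤ × ℤ) × (ℤ × ℤ)) :
    ‖fnlsTerm t a p - fnlsTerm t b p‖ ≤
      absProd (a - b) a a p + absProd b (a - b) a p + absProd b b (a - b) p := by
  rw [fnlsTerm, fnlsTerm, ← lp.single_sub, lp.norm_single one_pos, ← mul_sub, norm_mul]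
  refine (mul_le_of_le_one_left (norm_nonneg _) (norm_fnlsCoeff_le t p)).trans ?_
  have : a p.1 * (starRingEnd ℂ) (a p.2.1) * a p.2.2
      - b p.1 * (starRingEnd ℂ) (b p.2.1) * b p.2.2
      = (a - b) p.1 * ((starRingEnd ℂ) (a p.2.1) * a p.2.2)
        + b p.1 * ((starRingEnd ℂ) ((a - b) p.2.1) * a p.2.2)
        + b p.1 * ((starRingEnd ℂ) (b p.2.1) * (a - b) p.2.2) := by
    simp only [lp.coeFn_sub, Pi.sub_apply, map_sub]
    ring
  rw [this]
  refine norm_add₃_le.trans_eq ?_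
  simp only [norm_mul, RCLike.norm_conj, absProd]

theorem summable_fnlsTerm (t : ℝ) (a : EllOne) : Summable (fnlsTerm t a) :=
  (hasSum_absProd a a a).summable.of_norm_bounded (norm_fnlsTerm_le t a)

/-- The vector field `a ↦ i 𝒩(t)(a, a, a)` on `ℓ¹(ℤ²; ℂ)`. -/
def fnlsField (t : ℝ) (a : EllOne) : EllOne := Complex.I • ∑' p, fnlsTerm t a p

theorem norm_fnlsField_le (t : ℝ) (a : EllOne) : ‖fnlsField t a‖ ≤ ‖a‖ ^ 3 := by
  rw [fnlsField, norm_smul, Complex.norm_I, one_mul]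
  refine (tsum_of_norm_bounded (hasSum_absProd a a a) (norm_fnlsTerm_le t a)).trans_eq ?_
  ring

theorem norm_fnlsField_sub_le (t : ℝ) (a b : EllOne) :
    ‖fnlsField t a - fnlsField t b‖ ≤
      (‖a‖ * ‖a‖ + ‖b‖ * ‖a‖ + ‖b‖ * ‖b‖) * ‖a - b‖ := by
  rw [fnlsField, fnlsField, ← smul_sub, norm_smul, Complex.norm_I, one_mul,
    ← (summable_fnlsTerm t a).tsum_sub (summable_fnlsTerm t b)]
  refine (tsum_of_norm_bounded (((hasSum_absProd (a - b) a a).add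
    (hasSum_absProd b (a - b) a)).add (hasSum_absProd b b (a - b)))
    (norm_fnlsTerm_sub_le t a b)).trans_eq ?_
  ring

theorem lipschitzOnWith_fnlsField (t : ℝ) (R : ℝ≥0) :
    LipschitzOnWith (3 * R ^ 2) (fnlsField t) (closedBall 0 R) := by
  refine LipschitzOnWith.of_dist_le_mul fun a ha b hb => ?_
  rw [mem_closedBall_zero_iff] at ha hb
  rw [dist_eq_norm, dist_eq_norm]
  refine (norm_fnlsField_sub_le t a b).trans ?_
  gcongr
  calc ‖a‖ * ‖a‖ + ‖b‖ * ‖a‖ + ‖b‖ * ‖b‖ ≤ R * R + R * R + R * R := by gcongr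
    _ = ((3 * R ^ 2 : ℝ≥0) : ℝ) := by
      push_cast
      ring

theorem continuous_fnlsField_left (a : EllOne) : Continuous fun t => fnlsField t a := by
  have h : Continuous fun t => ∑' p, fnlsTerm t a p := by
    refine continuous_tsum (fun p => ?_) (hasSum_absProd a a a).summable
      fun p t => norm_fnlsTerm_le t a p
    exact (lp.isometry_single (E := fun _ : ℤ × ℤ => ℂ) (p := 1) (outFreq p)).continuous.comp
      ((continuous_fnlsCoeff p).mul continuous_const)
  exact h.const_smul Complex.I

theorem EllOne.exists_nnnorm_bound {S : Set ℝ} (hS : IsCompact S) {a : ℝ → EllOne}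
    (ha : ContinuousOn a S) : ∃ R : ℝ≥0, ∀ t ∈ S, a t ∈ closedBall (0 : EllOne) R := by
  obtain ⟨C, hC⟩ := hS.exists_bound_of_continuousOn ha
  exact ⟨C.toNNReal, fun t ht => mem_closedBall_zero_iff.2 <|
    (hC t ht).trans (Real.le_coe_toNNReal C)⟩

theorem continuousOn_uncurry_fnlsField (S : Set ℝ) (R : ℝ≥0) :
    ContinuousOn (Function.uncurry fnlsField) (S ×ˢ closedBall (0 : EllOne) (R : ℝ)) :=
  continuousOn_prod_of_continuousOn_lipschitzOnWith' (Function.uncurry fnlsField) (3 * R ^ 2)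
    (fun t _ => lipschitzOnWith_fnlsField t R)
    (fun b _ => (continuous_fnlsField_left b).continuousOn)

theorem continuousOn_fnlsField_comp {S : Set ℝ} (hS : IsCompact S) {a : ℝ → EllOne}
    (ha : ContinuousOn a S) : ContinuousOn (fun t => fnlsField t (a t)) S := by
  obtain ⟨R, hR⟩ := EllOne.exists_nnnorm_bound hS ha
  have hmaps : MapsTo (fun t => (t, a t)) S (S ×ˢ closedBall (0 : EllOne) (R : ℝ)) :=
    fun t ht => mk_mem_prod ht (hR t ht)
  have hpair : ContinuousOn (fun t => (t, a t)) S := continuousOn_id.prodMk ha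
  have hcomp := (continuousOn_uncurry_fnlsField S R).comp hpair hmaps
  simpa only [Function.comp_def, Function.uncurry_apply_pair] using hcomp

theorem fnlsTerm_apply (t : ℝ) (a : EllOne) (p : (ℤ × ℤ) × (ℤ × ℤ) × (ℤ × ℤ)) (n : ℤ × ℤ) :
    fnlsTerm t a p n = (Gam n).indicator (Nterm t a a a n) p
      + if p = (n, n, n) then -(a n * (starRingEnd ℂ) (a n) * a n) else 0 := by
  by_cases hn : n = outFreq p
  · subst hn
    rw [fnlsTerm, lp.single_apply_self, fnlsCoeff, sub_mul, sub_eq_add_neg]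
    congr 1
    · by_cases hg : p ∈ Gam (outFreq p)
      · rw [if_pos hg, indicator_of_mem hg, Nterm, mul_comm]
      · rw [if_neg hg, indicator_of_notMem hg, zero_mul]
    · have hiff : p = (p.2.1, p.2.1, p.2.1) ↔ p = (outFreq p, outFreq p, outFreq p) := by
        constructor <;> intro h
        · have : outFreq p = p.2.1 := by
            rw [h]
            simp [outFreq]
          rwa [this]
        · rw [Prod.ext_iff, Prod.ext_iff] at h ⊢
          simp_all
      rw [if_congr hiff rfl rfl]
      split_ifs with h
      · have h1 : p.1 = outFreq p := congrArg Prod.fst h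
        have h2 : p.2.1 = outFreq p := congrArg (fun q => q.2.1) h
        have h3 : p.2.2 = outFreq p := congrArg (fun q => q.2.2) h
        rw [h1, h2, h3, one_mul]
      · simp
  · rw [fnlsTerm, lp.single_apply_ne _ _ _ hn, indicator_of_notMem, if_neg, add_zero]
    · rintro rfl
      simp [outFreq] at hn
    · exact fun h => hn h.1.symm

theorem fnlsField_apply (t : ℝ) (a : EllOne) (n : ℤ × ℤ) :
    fnlsField t a n = Complex.I * Nop t a a a n := by
  have hs := (summable_fnlsTerm t a).hasSum.mapL
    (lp.evalCLM ℂ (fun _ : ℤ × ℤ => ℂ) 1 n)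
  have hd : HasSum (fun p : (ℤ × ℤ) × (ℤ × ℤ) × (ℤ × ℤ) =>
      if p = (n, n, n) then -(a n * (starRingEnd ℂ) (a n) * a n) else 0)
      (-(a n * (starRingEnd ℂ) (a n) * a n)) := hasSum_ite_eq _ _
  have hg := hs.sub hd
  have heq : (fun p => lp.evalCLM ℂ (fun _ : ℤ × ℤ => ℂ) 1 n (fnlsTerm t a p)
      - if p = (n, n, n) then -(a n * (starRingEnd ℂ) (a n) * a n) else 0)
      = (Gam n).indicator (Nterm t a a a n) := by
    funext p
    exact sub_eq_of_eq_add (fnlsTerm_apply t a p n)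
  rw [heq] at hg
  rw [Nop, tsum_subtype (Gam n) (Nterm t a a a n), hg.tsum_eq, add_sub_cancel]
  rfl

theorem neg_I_mul_eq_Nop_iff (t : ℝ) (a b : EllOne) :
    (∀ n, -Complex.I * b n = Nop t a a a n) ↔ b = fnlsField t a := by
  constructor
  · intro h
    ext n
    rw [fnlsField_apply, ← h n, ← mul_assoc]
    simp
  · rintro rfl n
    rw [fnlsField_apply, ← mul_assoc]
    simp

theorem isFNLSSolOn_iff {S : Set ℝ} (hS : IsCompact S) (a : ℝ → EllOne) :
    IsFNLSSolOn S a ↔ ∀ t ∈ S, HasDerivWithinAt a (fnlsField t (a t)) S t := by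
  constructor
  · rintro ⟨a', -, hd, he⟩ t ht
    rw [← (neg_I_mul_eq_Nop_iff t (a t) (a' t)).1 (he t ht)]
    exact hd t ht
  · intro h
    exact ⟨fun t => fnlsField t (a t),
      continuousOn_fnlsField_comp hS fun t ht => (h t ht).continuousWithinAt, h,
      fun t _ => (neg_I_mul_eq_Nop_iff t (a t) _).2 rfl⟩

theorem isPicardLindelof_fnlsField (a0 : EllOne) {T : ℝ} (hT : 0 ≤ T)
    (h : 8 * ‖a0‖ ^ 3 * T ≤ ‖a0‖) :
    IsPicardLindelof fnlsField (⟨0, neg_nonpos.2 hT, hT⟩ : Icc (-T) T) a0 ‖a0‖₊ 0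
      (8 * ‖a0‖₊ ^ 3) (3 * (2 * ‖a0‖₊) ^ 2) := by
  have hsub : closedBall a0 ‖a0‖₊ ⊆ closedBall 0 ((2 * ‖a0‖₊ : ℝ≥0) : ℝ) := by
    refine closedBall_subset_closedBall' ?_
    simp [two_mul]
  refine ⟨fun t _ => (lipschitzOnWith_fnlsField t _).mono hsub,
    fun x _ => (continuous_fnlsField_left x).continuousOn, fun t _ x hx => ?_, ?_⟩
  · have hx := mem_closedBall_zero_iff.1 (hsub hx)
    calc ‖fnlsField t x‖ ≤ ‖x‖ ^ 3 := norm_fnlsField_le t x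
      _ ≤ ((2 * ‖a0‖₊ : ℝ≥0) : ℝ) ^ 3 := by gcongr
      _ = ((8 * ‖a0‖₊ ^ 3 : ℝ≥0) : ℝ) := by
        push_cast
        ring
  · simpa using h

theorem IsFNLSSolOn.eqOn {T : ℝ} (hT : 0 < T) {a b : ℝ → EllOne} (hab : a 0 = b 0)
    (ha : IsFNLSSolOn (Icc (-T) T) a) (hb : IsFNLSSolOn (Icc (-T) T) b) :
    EqOn a b (Icc (-T) T) := by
  rw [isFNLSSolOn_iff isCompact_Icc] at ha hb
  have hca : ContinuousOn a (Icc (-T) T) := fun t ht => (ha t ht).continuousWithinAt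
  have hcb : ContinuousOn b (Icc (-T) T) := fun t ht => (hb t ht).continuousWithinAt
  obtain ⟨R, hR⟩ := EllOne.exists_nnnorm_bound isCompact_Icc hca
  obtain ⟨R', hR'⟩ := EllOne.exists_nnnorm_bound isCompact_Icc hcb
  refine ODE_solution_unique_of_mem_Icc (v := fnlsField)
    (s := fun _ => closedBall 0 ((max R R' : ℝ≥0) : ℝ)) (t₀ := 0)
    (fun t _ => lipschitzOnWith_fnlsField t _) ⟨neg_lt_zero.2 hT, hT⟩
    hca (fun t ht => (ha t (Ioo_subset_Icc_self ht)).hasDerivAt (Icc_mem_nhds ht.1 ht.2))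
    (fun t ht => closedBall_subset_closedBall ?_ (hR t (Ioo_subset_Icc_self ht)))
    hcb (fun t ht => (hb t (Ioo_subset_Icc_self ht)).hasDerivAt (Icc_mem_nhds ht.1 ht.2))
    (fun t ht => closedBall_subset_closedBall ?_ (hR' t (Ioo_subset_Icc_self ht))) hab
  · exact NNReal.coe_le_coe.2 (le_max_left R R')
  · exact NNReal.coe_le_coe.2 (le_max_right R R')

/-- Local well-posedness of `FNLS` in `ℓ¹(ℤ²)` on a time interval of length
`∼ ‖a(0)‖_{ℓ¹}^{−2}`. -/
theorem stmt2 :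
    ∃ c : ℝ, 0 < c ∧
      ∀ a0 : lp (fun _ : ℤ × ℤ => ℂ) 1, a0 ≠ 0 →
        ∀ T : ℝ, T = c / ‖a0‖ ^ 2 →
          (∃ a : ℝ → lp (fun _ : ℤ × ℤ => ℂ) 1,
            a 0 = a0 ∧ IsFNLSSolOn (Set.Icc (-T) T) a) ∧
          (∀ a₁ a₂ : ℝ → lp (fun _ : ℤ × ℤ => ℂ) 1,
            a₁ 0 = a0 → a₂ 0 = a0 →
            IsFNLSSolOn (Set.Icc (-T) T) a₁ → IsFNLSSolOn (Set.Icc (-T) T) a₂ →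
            Set.EqOn a₁ a₂ (Set.Icc (-T) T)) := by
  refine ⟨1 / 8, by norm_num, fun a0 ha0 T hT => ?_⟩
  have hpos : 0 < ‖a0‖ := norm_pos_iff.2 ha0
  have hT0 : 0 < T := by
    rw [hT]
    positivity
  refine ⟨?_, fun a₁ a₂ h₁ h₂ hs₁ hs₂ => hs₁.eqOn hT0 (h₁.trans h₂.symm) hs₂⟩
  have hbound : 8 * ‖a0‖ ^ 3 * T ≤ ‖a0‖ := by
    rw [hT]
    field_simp
    rfl
  obtain ⟨a, ha, hd⟩ :=
    (isPicardLindelof_fnlsField a0 hT0.le hbound).exists_eq_forall_mem_Icc_hasDerivWithinAt₀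
  exact ⟨a, ha, (isFNLSSolOn_iff isCompact_Icc a).2 hd⟩
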